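/- arXiv:2411.06844 — 6 statements merged into one kernel-verified Lean document; each statement's English description precedes it below -/
import Mathlib

section
/- Let N ≥ 3, Δx > 0, Δt > 0, let v_1,…,v_{N_v} ∈ ℝ be velocity nodes and ω_1,…,ω_{N_v} > 0 weights, and assume the CFL condition max_k |v_k| · Δt ≤ Δx. Then for every matrix f ∈ ℝ^{N×N_v} one has Δt · √(2π) ∑_{j,k} ( ∑_i ( D^x_{ji} f_{ik} v_k − (Δx/2) D^xx_{ji} f_{ik} |v_k| ) )² ω_k e^{3v_k²/2} − Δx · √(2π) ∑_{j,k} ( ∑_i D^+_{ji} f_{ik} )² |v_k| ω_k e^{3v_k²/2} ≤ 0; that is, Δt ‖D^x f diag(v_k) − (Δx/2) D^xx f diag(|v_k|)‖_H² − Δx ‖D^+ f diag(|v_k|^{1/2})‖_H² ≤ 0. -/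
open Finset

/-- Periodic first-order central-difference stencil matrix on `ℤ/Nℤ`:
`Dx j (j+1) = 1/(2Δx)`, `Dx j (j-1) = -1/(2Δx)`, zero otherwise. -/
noncomputable def Dx (N : ℕ) (Δx : ℝ) : ZMod N → ZMod N → ℝ := fun j i =>
  if i = j + 1 then 1 / (2 * Δx) else if i = j - 1 then -(1 / (2 * Δx)) else 0

/-- Periodic second-order central-difference stencil matrix on `ℤ/Nℤ`:
`Dxx j j = -2/Δx²`, `Dxx j (j±1) = 1/Δx²`, zero otherwise. -/
noncomputable def Dxx (N : ℕ) (Δx : ℝ) : ZMod N → ZMod N → ℝ := fun j i =>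
  if i = j then -2 / Δx ^ 2
  else if i = j + 1 then 1 / Δx ^ 2
  else if i = j - 1 then 1 / Δx ^ 2 else 0

/-- Periodic forward-difference stencil matrix on `ℤ/Nℤ`:
`Dplus j j = -1/Δx`, `Dplus j (j+1) = 1/Δx`, zero otherwise. -/
noncomputable def Dplus (N : ℕ) (Δx : ℝ) : ZMod N → ZMod N → ℝ := fun j i =>
  if i = j then -1 / Δx else if i = j + 1 then 1 / Δx else 0

/-- The squared `H`-norm `‖f‖_H² = √(2π) ∑_{j,k} f_{jk}² ω_k e^{3 v_k²/2}`. -/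
noncomputable def HnormSq {N Nv : ℕ} [NeZero N] (v ω : Fin Nv → ℝ)
    (f : ZMod N → Fin Nv → ℝ) : ℝ :=
  Real.sqrt (2 * Real.pi) *
    ∑ j : ZMod N, ∑ k : Fin Nv, (f j k) ^ 2 * ω k * Real.exp (3 * (v k) ^ 2 / 2)

theorem Dx_apply_aux {N : ℕ} [NeZero N] (hN : 3 ≤ N) (j : ZMod N) :
    j + 1 ≠ j ∧ j - 1 ≠ j ∧ j + 1 ≠ j - 1 := by
  have h1 : (1 : ZMod N) ≠ 0 := by
    intro h
    have h' : ((1 : ℕ) : ZMod N) = 0 := by exact_mod_cast h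
    rw [ZMod.natCast_eq_zero_iff] at h'
    exact absurd (Nat.le_of_dvd (by norm_num) h') (by omega)
  have h2 : (2 : ZMod N) ≠ 0 := by
    intro h
    have h' : ((2 : ℕ) : ZMod N) = 0 := by exact_mod_cast h
    rw [ZMod.natCast_eq_zero_iff] at h'
    exact absurd (Nat.le_of_dvd (by norm_num) h') (by omega)
  refine ⟨fun h => h1 ?_, fun h => h1 ?_, fun h => h2 ?_⟩
  · linear_combination h
  · linear_combination -h
  · linear_combination h

theorem stencil_sum {N : ℕ} [NeZero N] (hN : 3 ≤ N) (Δx : ℝ) (hΔx : 0 < Δx)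
    (g : ZMod N → ℝ) (w : ℝ) (j : ZMod N) :
    ∑ i : ZMod N, (Dx N Δx j i * g i * w - Δx / 2 * Dxx N Δx j i * g i * |w|)
      = ((g (j + 1) - g (j - 1)) * w - (g (j + 1) - 2 * g j + g (j - 1)) * |w|) / (2 * Δx) := by
  obtain ⟨h1, h2, h3⟩ := Dx_apply_aux hN j
  have key : ∀ i : ZMod N, Dx N Δx j i * g i * w - Δx / 2 * Dxx N Δx j i * g i * |w|
      = (if i = j then 2 * g j * |w| / (2 * Δx) else 0)
      + (if i = j + 1 then (g (j + 1) * w - g (j + 1) * |w|) / (2 * Δx) else 0)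
      + (if i = j - 1 then (-g (j - 1) * w - g (j - 1) * |w|) / (2 * Δx) else 0) := by
    intro i
    unfold Dx Dxx
    by_cases a : i = j
    · subst a
      simp only [h1.symm, h2.symm, if_true, if_false]
      field_simp
      ring
    by_cases b : i = j + 1
    · subst b
      simp only [h1, h3, if_true, if_false]
      field_simp
      ring
    by_cases c : i = j - 1
    · subst c
      simp only [h2, h3.symm, if_true, if_false]
      field_simp
      ring
    simp [a, b, c]
  simp only [key, Finset.sum_add_distrib, Finset.sum_ite_eq', Finset.mem_univ, if_true]
  ring

theorem Dplus_sum {N : ℕ} [NeZero N] (hN : 3 ≤ N) (Δx : ℝ)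
    (g : ZMod N → ℝ) (j : ZMod N) :
    ∑ i : ZMod N, Dplus N Δx j i * g i = (g (j + 1) - g j) / Δx := by
  obtain ⟨h1, h2, h3⟩ := Dx_apply_aux hN j
  have key : ∀ i : ZMod N, Dplus N Δx j i * g i
      = (if i = j then -g j / Δx else 0) + (if i = j + 1 then g (j + 1) / Δx else 0) := by
    intro i
    unfold Dplus
    by_cases a : i = j
    · subst a
      simp only [h1.symm, if_true, if_false]
      ring
    by_cases b : i = j + 1
    · subst b
      simp only [h1, if_true, if_false]
      ring
    simp [a, b]
  simp only [key, Finset.sum_add_distrib, Finset.sum_ite_eq', Finset.mem_univ, if_true]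
  ring

theorem stencil_sq_sum {N : ℕ} [NeZero N] (Δx : ℝ) (hΔx : 0 < Δx)
    (g : ZMod N → ℝ) (w : ℝ) :
    ∑ j : ZMod N,
      (((g (j + 1) - g (j - 1)) * w - (g (j + 1) - 2 * g j + g (j - 1)) * |w|) / (2 * Δx)) ^ 2
      = |w| ^ 2 * ∑ j : ZMod N, ((g (j + 1) - g j) / Δx) ^ 2 := by
  rw [Finset.mul_sum]
  rcases le_total 0 w with hw | hw
  · rw [abs_of_nonneg hw, ← Equiv.sum_comp (Equiv.addRight (1 : ZMod N))]
    refine Finset.sum_congr rfl fun j _ => ?_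
    simp only [Equiv.coe_addRight, add_sub_cancel_right]
    field_simp
    ring
  · rw [abs_of_nonpos hw]
    refine Finset.sum_congr rfl fun j _ => ?_
    field_simp
    ring

/-- CFL lemma: under the time step restriction `max_k |v_k| Δt ≤ Δx`,
`Δt ‖D^x f diag(v_k) − (Δx/2) D^xx f diag(|v_k|)‖_H² − Δx ‖D^+ f diag(|v_k|^{1/2})‖_H² ≤ 0`. -/
theorem CFL_stability_estimate (N Nv : ℕ) [NeZero N] (hN : 3 ≤ N) (hNv : 1 ≤ Nv)
    (Δx Δt : ℝ) (hΔx : 0 < Δx) (hΔt : 0 < Δt)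
    (v ω : Fin Nv → ℝ) (hω : ∀ k, 0 < ω k)
    (hCFL : ∀ k, |v k| * Δt ≤ Δx)
    (f : ZMod N → Fin Nv → ℝ) :
    Δt * HnormSq v ω (fun j k =>
        ∑ i : ZMod N, (Dx N Δx j i * f i k * v k - Δx / 2 * Dxx N Δx j i * f i k * |v k|))
      - Δx * HnormSq v ω (fun j k =>
        (∑ i : ZMod N, Dplus N Δx j i * f i k) * Real.sqrt |v k|) ≤ 0 := by
  unfold HnormSq
  simp only [stencil_sum hN Δx hΔx (fun i => f i _), Dplus_sum hN Δx (fun i => f i _)]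
  rw [Finset.sum_comm, Finset.sum_comm (f := fun (j : ZMod N) (k : Fin Nv) =>
    ((f (j + 1) k - f j k) / Δx * Real.sqrt |v k|) ^ 2 * ω k * Real.exp (3 * (v k) ^ 2 / 2))]
  simp only [← Finset.sum_mul, mul_pow, Real.sq_sqrt (abs_nonneg _)]
  have hsq := fun k => stencil_sq_sum Δx hΔx (fun i => f i k) (v k)
  simp only [hsq]
  have hle : Δt * ∑ k, |v k| ^ 2 * (∑ j, ((f (j + 1) k - f j k) / Δx) ^ 2) * ω k
        * Real.exp (3 * (v k) ^ 2 / 2)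
      ≤ Δx * ∑ k, (∑ j, ((f (j + 1) k - f j k) / Δx) ^ 2) * |v k| * ω k
        * Real.exp (3 * (v k) ^ 2 / 2) := by
    rw [Finset.mul_sum, Finset.mul_sum]
    refine Finset.sum_le_sum fun k _ => ?_
    have hS : 0 ≤ ∑ j, ((f (j + 1) k - f j k) / Δx) ^ 2 :=
      Finset.sum_nonneg fun j _ => sq_nonneg _
    have hc : 0 ≤ (∑ j, ((f (j + 1) k - f j k) / Δx) ^ 2) * |v k| * ω k
        * Real.exp (3 * (v k) ^ 2 / 2) :=
      mul_nonneg (mul_nonneg (mul_nonneg hS (abs_nonneg _)) (hω k).le) (Real.exp_pos _).le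
    have := mul_le_mul_of_nonneg_right (hCFL k) hc
    linarith
  have := mul_le_mul_of_nonneg_left hle (Real.sqrt_nonneg (2 * Real.pi))
  linarith
end

section
/- Consider sequences ρ^n ∈ ℝ^N and g^n ∈ ℝ^{N×N_v} (n ∈ ℕ) satisfying the fully discrete conservative scheme: for all n, j, k, g^{n+1}_{jk} = g^n_{jk} − Δt ∑_i (1/ρ^n_j) D^x_{ji} ρ^n_i g^n_{ik} v_k + Δt (Δx/2) ∑_i (1/ρ^n_j) D^xx_{ji} ρ^n_i g^n_{ik} |v_k| + σΔt (ρ^{n+1}_j/ρ^n_j)(1 − g^{n+1}_{jk}) − (g^{n+1}_{jk}/ρ^n_j)(ρ^{n+1}_j − ρ^n_j), and ρ^{n+1}_j = ρ^n_j − (Δt/√(2π)) ∑_{i,k} D^x_{ji} ρ^n_i g^n_{ik} v_k ω_k e^{v_k²/2} + (Δt Δx/(2√(2π))) ∑_{i,k} D^xx_{ji} ρ^n_i g^n_{ik} |v_k| ω_k e^{v_k²/2}. Assume σ Δt ≥ 0, ρ^n_j ≠ 0 for all n and j, the quadrature normalization ∑_k ω_k e^{v_k²/2} = √(2π), and the initial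 condition (1/√(2π)) ∑_k g^0_{jk} ω_k e^{v_k²/2} = 1 for all j. Then for all n ∈ ℕ and all j, the discrete solution f^n_{jk} = (1/√(2π)) ρ^n_j g^n_{jk} e^{−v_k²/2} satisfies ∑_{k=1}^{N_v} f^n_{jk} ω_k e^{v_k²} = ρ^n_j. -/
open Finset

/-- Conservation of the discrete moment: for the fully discrete conservative scheme,
if initially `(1/√(2π)) ∑_k g⁰_{jk} ω_k e^{v_k²/2} = 1`, then for all `n` and `j` the
discrete solution `f^n_{jk} = (1/√(2π)) ρ^n_j g^n_{jk} e^{−v_k²/2}` satisfies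
`∑_k f^n_{jk} ω_k e^{v_k²} = ρ^n_j`. -/
theorem discrete_moment_conservation (N Nv : ℕ) [NeZero N] (hN : 3 ≤ N) (hNv : 1 ≤ Nv)
    (Δx Δt σ : ℝ) (hΔx : 0 < Δx) (hΔt : 0 < Δt) (hσΔt : 0 ≤ σ * Δt)
    (v ω : Fin Nv → ℝ) (hω : ∀ k, 0 < ω k)
    (ρ : ℕ → ZMod N → ℝ) (g : ℕ → ZMod N → Fin Nv → ℝ)
    (hρ0 : ∀ n j, ρ n j ≠ 0)
    (hquad : ∑ k : Fin Nv, ω k * Real.exp ((v k) ^ 2 / 2) = Real.sqrt (2 * Real.pi))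
    (hinit : ∀ j, (1 / Real.sqrt (2 * Real.pi)) *
        ∑ k : Fin Nv, g 0 j k * ω k * Real.exp ((v k) ^ 2 / 2) = 1)
    (hg : ∀ n (j : ZMod N) (k : Fin Nv), g (n + 1) j k = g n j k
        - Δt * ∑ i : ZMod N, (1 / ρ n j) * Dx N Δx j i * (ρ n i * g n i k) * v k
        + Δt * (Δx / 2) * ∑ i : ZMod N, (1 / ρ n j) * Dxx N Δx j i * (ρ n i * g n i k) * |v k|
        + σ * Δt * (ρ (n + 1) j / ρ n j) * (1 - g (n + 1) j k)
        - (g (n + 1) j k / ρ n j) * (ρ (n + 1) j - ρ n j))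
    (hρ : ∀ n (j : ZMod N), ρ (n + 1) j = ρ n j
        - (Δt / Real.sqrt (2 * Real.pi)) * ∑ i : ZMod N, ∑ k : Fin Nv,
            Dx N Δx j i * (ρ n i * g n i k) * v k * ω k * Real.exp ((v k) ^ 2 / 2)
        + (Δt * Δx / (2 * Real.sqrt (2 * Real.pi))) * ∑ i : ZMod N, ∑ k : Fin Nv,
            Dxx N Δx j i * (ρ n i * g n i k) * |v k| * ω k * Real.exp ((v k) ^ 2 / 2)) :
    ∀ n (j : ZMod N),
      ∑ k : Fin Nv, ((1 / Real.sqrt (2 * Real.pi)) * ρ n j * g n j k * Real.exp (-(v k) ^ 2 / 2))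
          * ω k * Real.exp ((v k) ^ 2) = ρ n j := by
  have hs : Real.sqrt (2 * Real.pi) ≠ 0 := by positivity
  set s := Real.sqrt (2 * Real.pi) with hsdef
  have key : ∀ n (j : ZMod N), ∑ k : Fin Nv, g n j k * (ω k * Real.exp ((v k) ^ 2 / 2)) = s := by
    intro n
    induction n with
    | zero =>
      intro j
      have h := hinit j
      field_simp at h
      rw [← h]
      exact Finset.sum_congr rfl fun k _ => by ring_nf
    | succ n ih =>
      intro j
      have h0 := hρ0 n j
      have h1 := hρ0 (n + 1) j
      have hA : ∀ k, ρ (n + 1) j * (1 + σ * Δt) * g (n + 1) j k = ρ n j * g n j k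
          - Δt * (∑ i : ZMod N, Dx N Δx j i * (ρ n i * g n i k) * v k)
          + Δt * (Δx / 2) * (∑ i : ZMod N, Dxx N Δx j i * (ρ n i * g n i k) * |v k|)
          + σ * Δt * ρ (n + 1) j := by
        intro k
        have h := hg n j k
        have e1 : ∑ i : ZMod N, (1 / ρ n j) * Dx N Δx j i * (ρ n i * g n i k) * v k
            = (1 / ρ n j) * ∑ i : ZMod N, Dx N Δx j i * (ρ n i * g n i k) * v k := by
          rw [Finset.mul_sum]
          exact Finset.sum_congr rfl fun i _ => by ring
        have e2 : ∑ i : ZMod N, (1 / ρ n j) * Dxx N Δx j i * (ρ n i * g n i k) * |v k|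
            = (1 / ρ n j) * ∑ i : ZMod N, Dxx N Δx j i * (ρ n i * g n i k) * |v k| := by
          rw [Finset.mul_sum]
          exact Finset.sum_congr rfl fun i _ => by ring
        rw [e1, e2] at h
        generalize (∑ i : ZMod N, Dx N Δx j i * (ρ n i * g n i k) * v k) = A at h ⊢
        generalize (∑ i : ZMod N, Dxx N Δx j i * (ρ n i * g n i k) * |v k|) = B at h ⊢
        generalize g (n + 1) j k = g' at h ⊢
        field_simp at h
        linarith
      have e3 : ∑ i : ZMod N, ∑ k : Fin Nv,
            Dx N Δx j i * (ρ n i * g n i k) * v k * ω k * Real.exp ((v k) ^ 2 / 2)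
          = ∑ k : Fin Nv, (∑ i : ZMod N, Dx N Δx j i * (ρ n i * g n i k) * v k)
            * (ω k * Real.exp ((v k) ^ 2 / 2)) := by
        rw [Finset.sum_comm]
        refine Finset.sum_congr rfl fun k _ => ?_
        rw [Finset.sum_mul]
        exact Finset.sum_congr rfl fun i _ => by ring
      have e4 : ∑ i : ZMod N, ∑ k : Fin Nv,
            Dxx N Δx j i * (ρ n i * g n i k) * |v k| * ω k * Real.exp ((v k) ^ 2 / 2)
          = ∑ k : Fin Nv, (∑ i : ZMod N, Dxx N Δx j i * (ρ n i * g n i k) * |v k|)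
            * (ω k * Real.exp ((v k) ^ 2 / 2)) := by
        rw [Finset.sum_comm]
        refine Finset.sum_congr rfl fun k _ => ?_
        rw [Finset.sum_mul]
        exact Finset.sum_congr rfl fun i _ => by ring
      have hr := hρ n j
      rw [e3, e4] at hr
      have hsum : ρ (n + 1) j * (1 + σ * Δt)
            * ∑ k : Fin Nv, g (n + 1) j k * (ω k * Real.exp ((v k) ^ 2 / 2))
          = ρ n j * ∑ k : Fin Nv, g n j k * (ω k * Real.exp ((v k) ^ 2 / 2))
          - Δt * (∑ k : Fin Nv, (∑ i : ZMod N, Dx N Δx j i * (ρ n i * g n i k) * v k)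
            * (ω k * Real.exp ((v k) ^ 2 / 2)))
          + Δt * (Δx / 2) * (∑ k : Fin Nv,
            (∑ i : ZMod N, Dxx N Δx j i * (ρ n i * g n i k) * |v k|)
            * (ω k * Real.exp ((v k) ^ 2 / 2)))
          + σ * Δt * ρ (n + 1) j * ∑ k : Fin Nv, ω k * Real.exp ((v k) ^ 2 / 2) := by
        simp only [Finset.mul_sum (s := (Finset.univ : Finset (Fin Nv)))]
        rw [← Finset.sum_sub_distrib, ← Finset.sum_add_distrib, ← Finset.sum_add_distrib]
        refine Finset.sum_congr rfl fun k _ => ?_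
        rw [← mul_assoc, hA k]
        ring
      rw [ih j, hquad] at hsum
      generalize (∑ k : Fin Nv, (∑ i : ZMod N, Dx N Δx j i * (ρ n i * g n i k) * v k)
            * (ω k * Real.exp ((v k) ^ 2 / 2))) = A at hr hsum
      generalize (∑ k : Fin Nv, (∑ i : ZMod N, Dxx N Δx j i * (ρ n i * g n i k) * |v k|)
            * (ω k * Real.exp ((v k) ^ 2 / 2))) = B at hr hsum
      have hpos : (1 + σ * Δt) ≠ 0 := by positivity
      have hr' : ρ (n + 1) j * s = ρ n j * s - Δt * A + Δt * (Δx / 2) * B := by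
        rw [hr]
        field_simp
      apply mul_left_cancel₀ (mul_ne_zero h1 hpos)
      rw [hsum]
      linear_combination -hr'
  intro n j
  have hk : ∀ k, ((1 / s) * ρ n j * g n j k * Real.exp (-(v k) ^ 2 / 2))
      * ω k * Real.exp ((v k) ^ 2)
      = (1 / s * ρ n j) * (g n j k * (ω k * Real.exp ((v k) ^ 2 / 2))) := by
    intro k
    have : Real.exp ((v k) ^ 2 / 2) = Real.exp (-(v k) ^ 2 / 2) * Real.exp ((v k) ^ 2) := by
      rw [← Real.exp_add]
      ring_nf
    rw [this]
    ring
  rw [Finset.sum_congr rfl fun k _ => hk k, ← Finset.mul_sum, key n j]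
  field_simp
end

section
/- Let ρ^n, ρ^{n+1} ∈ ℝ^N and g^n, g^{n+1} ∈ ℝ^{N×N_v} satisfy one step of the fully discrete conservative scheme: for all j, k, g^{n+1}_{jk} = g^n_{jk} − Δt ∑_i (1/ρ^n_j) D^x_{ji} ρ^n_i g^n_{ik} v_k + Δt (Δx/2) ∑_i (1/ρ^n_j) D^xx_{ji} ρ^n_i g^n_{ik} |v_k| + σΔt (ρ^{n+1}_j/ρ^n_j)(1 − g^{n+1}_{jk}) − (g^{n+1}_{jk}/ρ^n_j)(ρ^{n+1}_j − ρ^n_j), and ρ^{n+1}_j = ρ^n_j − (Δt/√(2π)) ∑_{i,k} D^x_{ji} ρ^n_i g^n_{ik} v_k ω_k e^{v_k²/2} + (Δt Δx/(2√(2π))) ∑_{i,k} D^xx_{ji} ρ^n_i g^n_{ik} |v_k| ω_k e^{v_k²/2}. Assume σ ≥ 0, Δt > 0, ρ^n_j ≠ 0 for all j, the quadrature normalization ∑_k ω_k e^{v_k²/2} = √(2π), the moment condition ∑_k g^n_{jk} ω_k e^{v_k²/2} = √(2π) for all j, and the CFL condition max_k |v_k| · Δt ≤ Δx. Then, with f^m_{jk}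 = (1/√(2π)) ρ^m_j g^m_{jk} e^{−v_k²/2} for m ∈ {n, n+1}, the scheme is numerically stable in the H-norm: ‖f^{n+1}‖_H² ≤ ‖f^n‖_H². -/
open Finset

lemma aux_ne {N : ℕ} (hN : 3 ≤ N) : (1 : ZMod N) ≠ 0 ∧ (2 : ZMod N) ≠ 0 := by
  constructor
  · intro h
    have h' : ((1 : ℕ) : ZMod N) = 0 := by exact_mod_cast h
    rw [ZMod.natCast_eq_zero_iff] at h'
    have := Nat.le_of_dvd (by norm_num) h'
    omega
  · intro h
    have h' : ((2 : ℕ) : ZMod N) = 0 := by exact_mod_cast h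
    rw [ZMod.natCast_eq_zero_iff] at h'
    have := Nat.le_of_dvd (by norm_num) h'
    omega

lemma Dx_sum {N : ℕ} [NeZero N] (hN : 3 ≤ N) (Δx : ℝ) (h : ZMod N → ℝ) (j : ZMod N) :
    ∑ i, Dx N Δx j i * h i = (h (j + 1) - h (j - 1)) * (1 / (2 * Δx)) := by
  obtain ⟨h1, h2⟩ := aux_ne hN
  have hne : j - 1 ≠ j + 1 := by
    intro e; apply h2; linear_combination -e
  have key : ∀ i, Dx N Δx j i * h i = (if i = j + 1 then 1 / (2 * Δx) * h i else 0)
      + (if i = j - 1 then -(1 / (2 * Δx)) * h i else 0) := by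
    intro i
    unfold Dx
    by_cases a : i = j + 1
    · have : i ≠ j - 1 := by rw [a]; exact hne.symm
      rw [if_pos a, if_pos a, if_neg this]; ring
    · rw [if_neg a, if_neg a]; split_ifs <;> ring
  rw [Finset.sum_congr rfl (fun i _ => key i), Finset.sum_add_distrib]
  simp only [Finset.sum_ite_eq', Finset.mem_univ, if_true]
  ring

lemma Dxx_sum {N : ℕ} [NeZero N] (hN : 3 ≤ N) (Δx : ℝ) (h : ZMod N → ℝ) (j : ZMod N) :
    ∑ i, Dxx N Δx j i * h i = (h (j + 1) - 2 * h j + h (j - 1)) * (1 / Δx ^ 2) := by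
  obtain ⟨h1, h2⟩ := aux_ne hN
  have hne : j - 1 ≠ j + 1 := by
    intro e; apply h2; linear_combination -e
  have hne1 : j ≠ j + 1 := by
    intro e; apply h1; linear_combination -e
  have hne2 : j ≠ j - 1 := by
    intro e; apply h1; linear_combination e
  have key : ∀ i, Dxx N Δx j i * h i = (if i = j then -2 / Δx ^ 2 * h i else 0)
      + (if i = j + 1 then 1 / Δx ^ 2 * h i else 0)
      + (if i = j - 1 then 1 / Δx ^ 2 * h i else 0) := by
    intro i
    unfold Dxx
    by_cases a : i = j
    · have b : i ≠ j + 1 := by rw [a]; exact hne1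
      have c : i ≠ j - 1 := by rw [a]; exact hne2
      rw [if_pos a, if_pos a, if_neg b, if_neg c]; ring
    · rw [if_neg a, if_neg a]
      by_cases b : i = j + 1
      · have : i ≠ j - 1 := by rw [b]; exact hne.symm
        rw [if_pos b, if_pos b, if_neg this]; ring
      · rw [if_neg b, if_neg b]; split_ifs <;> ring
  rw [Finset.sum_congr rfl (fun i _ => key i), Finset.sum_add_distrib, Finset.sum_add_distrib]
  simp only [Finset.sum_ite_eq', Finset.mem_univ, if_true]
  ring

lemma conv3 (a b x y z : ℝ) (ha : 0 ≤ a) (hb : 0 ≤ b) (hc : a + b ≤ 1) :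
    ((1 - a - b) * x + a * y + b * z) ^ 2 ≤ (1 - a - b) * x ^ 2 + a * y ^ 2 + b * z ^ 2 := by
  have h : 0 ≤ 1 - a - b := by linarith
  have h1 := mul_nonneg (mul_nonneg h ha) (sq_nonneg (x - y))
  have h2 := mul_nonneg (mul_nonneg h hb) (sq_nonneg (x - z))
  have h3 := mul_nonneg (mul_nonneg ha hb) (sq_nonneg (y - z))
  linear_combination h1 + h2 + h3

lemma transport_le {N : ℕ} [NeZero N] (a b : ℝ) (ha : 0 ≤ a) (hb : 0 ≤ b) (hc : a + b ≤ 1)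
    (u : ZMod N → ℝ) :
    ∑ j, ((1 - a - b) * u j + a * u (j + 1) + b * u (j - 1)) ^ 2 ≤ ∑ j, u j ^ 2 := by
  have e1 : ∑ j, u (j + 1) ^ 2 = ∑ j, u j ^ 2 :=
    Equiv.sum_comp (Equiv.addRight (1 : ZMod N)) (fun j => u j ^ 2)
  have e2 : ∑ j, u (j - 1) ^ 2 = ∑ j, u j ^ 2 :=
    Equiv.sum_comp (Equiv.subRight (1 : ZMod N)) (fun j => u j ^ 2)
  refine (Finset.sum_le_sum (fun j _ => conv3 a b _ _ _ ha hb hc)).trans ?_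
  rw [Finset.sum_add_distrib, Finset.sum_add_distrib, ← Finset.mul_sum, ← Finset.mul_sum,
    ← Finset.mul_sum, e1, e2]
  apply le_of_eq; ring

/-- Relaxation towards the mean does not increase the weighted square sum. -/
lemma relax_le {Nv : ℕ} (W A w : Fin Nv → ℝ) (S r s : ℝ) (hS : ∑ k, W k = S)
    (hW : ∀ k, 0 < W k) (hs : 0 ≤ s) (hr : S * r = ∑ k, A k * W k)
    (hw : ∀ k, w k * (1 + s) = A k + s * r) :
    ∑ k, w k ^ 2 * W k ≤ ∑ k, A k ^ 2 * W k := by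
  have hvar : 0 ≤ ∑ k, (A k - r) ^ 2 * W k :=
    Finset.sum_nonneg (fun k _ => mul_nonneg (sq_nonneg _) (hW k).le)
  have hvar' : ∑ k, (A k - r) ^ 2 * W k = ∑ k, A k ^ 2 * W k - S * r ^ 2 := by
    have : ∀ k, (A k - r) ^ 2 * W k = A k ^ 2 * W k - 2 * r * (A k * W k) + r ^ 2 * W k := by
      intro k; ring
    rw [Finset.sum_congr rfl (fun k _ => this k), Finset.sum_add_distrib,
      Finset.sum_sub_distrib, ← Finset.mul_sum, ← Finset.mul_sum, hS, ← hr]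
    ring
  have h1 : ∀ k, (1 + s) * (w k ^ 2 * W k) ≤ A k ^ 2 * W k + s * r ^ 2 * W k := by
    intro k
    have hp : 0 < 1 + s := by linarith
    have : (1 + s) * w k ^ 2 ≤ A k ^ 2 + s * r ^ 2 := by
      have e : A k = w k * (1 + s) - s * r := by linarith [hw k]
      rw [e]
      have := mul_nonneg (mul_nonneg hs hp.le) (sq_nonneg (w k - r))
      linear_combination this
    have := mul_le_mul_of_nonneg_right this (hW k).le
    linear_combination this
  have h2 := Finset.sum_le_sum (fun k (_ : k ∈ Finset.univ) => h1 k)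
  rw [← Finset.mul_sum, Finset.sum_add_distrib, ← Finset.mul_sum, hS] at h2
  have h3 := mul_nonneg hs (hvar'.symm ▸ hvar : 0 ≤ ∑ k, A k ^ 2 * W k - S * r ^ 2)
  have hp : 0 < 1 + s := by linarith
  refine le_of_mul_le_mul_left ?_ hp
  linarith

/-- Numerical stability of the fully discrete conservative scheme: under the CFL
condition `max_k |v_k| Δt ≤ Δx`, one step of the scheme satisfies
`‖f^{n+1}‖_H² ≤ ‖f^n‖_H²` where `f^m_{jk} = (1/√(2π)) ρ^m_j g^m_{jk} e^{−v_k²/2}`. -/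
theorem scheme_numerically_stable (N Nv : ℕ) [NeZero N] (hN : 3 ≤ N) (hNv : 1 ≤ Nv)
    (Δx Δt σ : ℝ) (hΔx : 0 < Δx) (hΔt : 0 < Δt) (hσ : 0 ≤ σ)
    (v ω : Fin Nv → ℝ) (hω : ∀ k, 0 < ω k)
    (ρn ρn1 : ZMod N → ℝ) (gn gn1 : ZMod N → Fin Nv → ℝ)
    (hρn : ∀ j, ρn j ≠ 0)
    (hquad : ∑ k : Fin Nv, ω k * Real.exp ((v k) ^ 2 / 2) = Real.sqrt (2 * Real.pi))
    (hmom : ∀ j, ∑ k : Fin Nv, gn j k * ω k * Real.exp ((v k) ^ 2 / 2) = Real.sqrt (2 * Real.pi))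
    (hCFL : ∀ k, |v k| * Δt ≤ Δx)
    (hg : ∀ (j : ZMod N) (k : Fin Nv), gn1 j k = gn j k
        - Δt * ∑ i : ZMod N, (1 / ρn j) * Dx N Δx j i * (ρn i * gn i k) * v k
        + Δt * (Δx / 2) * ∑ i : ZMod N, (1 / ρn j) * Dxx N Δx j i * (ρn i * gn i k) * |v k|
        + σ * Δt * (ρn1 j / ρn j) * (1 - gn1 j k)
        - (gn1 j k / ρn j) * (ρn1 j - ρn j))
    (hρ : ∀ j : ZMod N, ρn1 j = ρn j
        - (Δt / Real.sqrt (2 * Real.pi)) * ∑ i : ZMod N, ∑ k : Fin Nv,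
            Dx N Δx j i * (ρn i * gn i k) * v k * ω k * Real.exp ((v k) ^ 2 / 2)
        + (Δt * Δx / (2 * Real.sqrt (2 * Real.pi))) * ∑ i : ZMod N, ∑ k : Fin Nv,
            Dxx N Δx j i * (ρn i * gn i k) * |v k| * ω k * Real.exp ((v k) ^ 2 / 2)) :
    HnormSq v ω (fun j k =>
        (1 / Real.sqrt (2 * Real.pi)) * ρn1 j * gn1 j k * Real.exp (-(v k) ^ 2 / 2))
      ≤ HnormSq v ω (fun j k =>
        (1 / Real.sqrt (2 * Real.pi)) * ρn j * gn j k * Real.exp (-(v k) ^ 2 / 2)) := by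
  set S := Real.sqrt (2 * Real.pi) with hSdef
  have hS : 0 < S := Real.sqrt_pos.mpr (by positivity)
  set W : Fin Nv → ℝ := fun k => ω k * Real.exp ((v k) ^ 2 / 2) with hWdef
  have hW : ∀ k, 0 < W k := fun k => mul_pos (hω k) (Real.exp_pos _)
  set a : Fin Nv → ℝ := fun k => Δt * (|v k| - v k) / (2 * Δx) with hadef
  set b : Fin Nv → ℝ := fun k => Δt * (|v k| + v k) / (2 * Δx) with hbdef
  have ha : ∀ k, 0 ≤ a k := fun k =>
    div_nonneg (mul_nonneg hΔt.le (by linarith [le_abs_self (v k)])) (by positivity)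
  have hb : ∀ k, 0 ≤ b k := fun k =>
    div_nonneg (mul_nonneg hΔt.le (by linarith [neg_abs_le (v k)])) (by positivity)
  have hab : ∀ k, a k + b k ≤ 1 := by
    intro k
    have : a k + b k = |v k| * Δt / Δx := by
      simp only [hadef, hbdef]; field_simp; ring
    rw [this, div_le_one hΔx]
    exact hCFL k
  set u : ZMod N → Fin Nv → ℝ := fun j k => ρn j * gn j k with hudef
  set A : ZMod N → Fin Nv → ℝ := fun j k =>
    (1 - a k - b k) * u j k + a k * u (j + 1) k + b k * u (j - 1) k with hAdef
  -- the two stencil sums, combined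
  have hA : ∀ j k, A j k = u j k
      - Δt * v k * ((u (j + 1) k - u (j - 1) k) * (1 / (2 * Δx)))
      + Δt * (Δx / 2) * |v k| * ((u (j + 1) k - 2 * u j k + u (j - 1) k) * (1 / Δx ^ 2)) := by
    intro j k
    simp only [hAdef, hadef, hbdef]
    field_simp
    ring
  have hw : ∀ j k, (ρn1 j * gn1 j k) * (1 + σ * Δt) = A j k + σ * Δt * ρn1 j := by
    intro j k
    have e1 : ∑ i : ZMod N, (1 / ρn j) * Dx N Δx j i * (ρn i * gn i k) * v k
        = (1 / ρn j) * v k * ((u (j + 1) k - u (j - 1) k) * (1 / (2 * Δx))) := by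
      rw [← Dx_sum hN Δx (fun i => u i k) j, Finset.mul_sum]
      exact Finset.sum_congr rfl (fun i _ => by simp only [hudef]; ring)
    have e2 : ∑ i : ZMod N, (1 / ρn j) * Dxx N Δx j i * (ρn i * gn i k) * |v k|
        = (1 / ρn j) * |v k| * ((u (j + 1) k - 2 * u j k + u (j - 1) k) * (1 / Δx ^ 2)) := by
      rw [← Dxx_sum hN Δx (fun i => u i k) j, Finset.mul_sum]
      exact Finset.sum_congr rfl (fun i _ => by simp only [hudef]; ring)
    have h := hg j k
    rw [e1, e2] at h
    rw [hA]
    generalize (u (j + 1) k - u (j - 1) k) * (1 / (2 * Δx)) = P at *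
    generalize (u (j + 1) k - 2 * u j k + u (j - 1) k) * (1 / Δx ^ 2) = Q at *
    have hu : u j k = ρn j * gn j k := rfl
    rw [hu]
    have hr := mul_inv_cancel₀ (hρn j)
    simp only [div_eq_mul_inv, one_mul] at h ⊢
    linear_combination ρn j * h + (-Δt * v k * P + Δt * (Δx * 2⁻¹) * |v k| * Q
      + σ * Δt * ρn1 j * (1 - gn1 j k) - gn1 j k * (ρn1 j - ρn j)) * hr
  have hr : ∀ j, S * ρn1 j = ∑ k, A j k * W k := by
    intro j
    have e1 : ∑ i : ZMod N, ∑ k : Fin Nv,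
            Dx N Δx j i * (ρn i * gn i k) * v k * ω k * Real.exp ((v k) ^ 2 / 2)
        = ∑ k, v k * ((u (j + 1) k - u (j - 1) k) * (1 / (2 * Δx))) * W k := by
      rw [Finset.sum_comm]
      refine Finset.sum_congr rfl (fun k _ => ?_)
      rw [← Dx_sum hN Δx (fun i => u i k) j, Finset.mul_sum, Finset.sum_mul]
      exact Finset.sum_congr rfl (fun i _ => by simp only [hudef, hWdef]; ring)
    have e2 : ∑ i : ZMod N, ∑ k : Fin Nv,
            Dxx N Δx j i * (ρn i * gn i k) * |v k| * ω k * Real.exp ((v k) ^ 2 / 2)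
        = ∑ k, |v k| * ((u (j + 1) k - 2 * u j k + u (j - 1) k) * (1 / Δx ^ 2)) * W k := by
      rw [Finset.sum_comm]
      refine Finset.sum_congr rfl (fun k _ => ?_)
      rw [← Dxx_sum hN Δx (fun i => u i k) j, Finset.mul_sum, Finset.sum_mul]
      exact Finset.sum_congr rfl (fun i _ => by simp only [hudef, hWdef]; ring)
    have e3 : ∑ k, u j k * W k = S * ρn j := by
      rw [← hmom j, Finset.sum_mul]
      exact Finset.sum_congr rfl (fun k _ => by simp only [hudef, hWdef]; ring)
    have e4 : ∑ k, A j k * W k = ∑ k, u j k * W k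
        - Δt * ∑ k, v k * ((u (j + 1) k - u (j - 1) k) * (1 / (2 * Δx))) * W k
        + Δt * (Δx / 2) *
          ∑ k, |v k| * ((u (j + 1) k - 2 * u j k + u (j - 1) k) * (1 / Δx ^ 2)) * W k := by
      rw [Finset.mul_sum, Finset.mul_sum, ← Finset.sum_sub_distrib, ← Finset.sum_add_distrib]
      exact Finset.sum_congr rfl (fun k _ => by rw [hA]; ring)
    rw [e4, e3, ← e1, ← e2, hρ j]
    field_simp
  have hmain : ∑ j, ∑ k, (ρn1 j * gn1 j k) ^ 2 * W k ≤ ∑ j, ∑ k, (ρn j * gn j k) ^ 2 * W k := by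
    refine (Finset.sum_le_sum (fun (j : ZMod N) _ => relax_le W (A j) (fun k => ρn1 j * gn1 j k) S (ρn1 j)
      (σ * Δt) hquad hW (mul_nonneg hσ hΔt.le) (hr j) (hw j))).trans ?_
    rw [Finset.sum_comm,
      Finset.sum_comm (f := fun (j : ZMod N) (k : Fin Nv) => (ρn j * gn j k) ^ 2 * W k)]
    refine Finset.sum_le_sum (fun k _ => ?_)
    rw [← Finset.sum_mul, ← Finset.sum_mul]
    exact mul_le_mul_of_nonneg_right
      (transport_le (a k) (b k) (ha k) (hb k) (hab k) (fun j => u j k)) (hW k).le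
  have hnorm : ∀ (r : ZMod N → ℝ) (g : ZMod N → Fin Nv → ℝ),
      HnormSq v ω (fun j k => (1 / S) * r j * g j k * Real.exp (-(v k) ^ 2 / 2))
        = S * (1 / S) ^ 2 * ∑ j, ∑ k, (r j * g j k) ^ 2 * W k := by
    intro r g
    unfold HnormSq
    rw [← hSdef, mul_assoc]
    congr 1
    rw [Finset.mul_sum]
    refine Finset.sum_congr rfl (fun j _ => ?_)
    rw [Finset.mul_sum]
    refine Finset.sum_congr rfl (fun k _ => ?_)
    have he : Real.exp (-(v k) ^ 2 / 2) ^ 2 * Real.exp (3 * (v k) ^ 2 / 2)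
        = Real.exp ((v k) ^ 2 / 2) := by
      rw [sq, ← Real.exp_add, ← Real.exp_add]
      congr 1; ring
    simp only [hWdef]
    rw [← he]
    ring
  rw [hnorm, hnorm]
  exact mul_le_mul_of_nonneg_left hmain (by positivity)
end

section
/- Suppose g^n_{jk} = 1 for all j, k (constant solution), σ = 0, ρ^n_j ≠ 0 for all j, and ρ^{n+1} ∈ ℝ^N, g^{n+1} ∈ ℝ^{N×N_v} satisfy the naive fully discrete advection-form scheme: for all j, k, g^{n+1}_{jk} = g^n_{jk} − Δt ∑_i D^x_{ji} g^n_{ik} v_k + Δt (Δx/2) ∑_i D^xx_{ji} g^n_{ik} |v_k| + σΔt (1 − g^{n+1}_{jk}) − (g^{n+1}_{jk}/ρ^n_j)(ρ^{n+1}_j − ρ^n_j) − Δt (g^n_{jk}/ρ^n_j) ∑_i D^x_{ji} ρ^n_i v_k. Then, with f^n_{jk} = (1/√(2π)) ρ^n_j g^n_{jk} e^{−v_k²/2} and f^{n+1}_{jk} = (1/√(2π)) ρ^{n+1}_j g^{n+1}_{jk} e^{−v_k²/2}, one has the reduction f^{n+1}_{jk} = f^n_{jk} − Δt ∑_i D^x_{ji}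 f^n_{ik} v_k for all j, k; i.e. the scheme reduces to the explicit Euler centered finite-difference discretization of ∂_t f + v ∂_x f = 0. -/
open Finset

theorem aux_nat_ne {N : ℕ} (n : ℕ) (h0 : 0 < n) (h : n < N) : ((n : ℕ) : ZMod N) ≠ 0 := by
  rw [Ne, ZMod.natCast_eq_zero_iff]
  exact fun hd => absurd (Nat.le_of_dvd h0 hd) (by omega)

theorem aux_Dx_sum (N : ℕ) [NeZero N] (hN : 3 ≤ N) (Δx : ℝ) (j : ZMod N) :
    ∑ i : ZMod N, Dx N Δx j i = 0 := by
  have h2 : (2 : ZMod N) ≠ 0 := by exact_mod_cast aux_nat_ne (N := N) 2 (by omega) (by omega)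
  have hne : j + 1 ≠ j - 1 := fun h => h2 (by linear_combination h)
  have : ∀ i : ZMod N, Dx N Δx j i = (if i = j + 1 then 1 / (2 * Δx) else 0)
      + (if i = j - 1 then -(1 / (2 * Δx)) else 0) := by
    intro i
    unfold Dx
    by_cases h : i = j + 1
    · subst h
      simp [hne]
    · simp [h]
  simp only [this, Finset.sum_add_distrib, Finset.sum_ite_eq', Finset.mem_univ, if_true]
  ring

theorem aux_Dxx_sum (N : ℕ) [NeZero N] (hN : 3 ≤ N) (Δx : ℝ) (j : ZMod N) :
    ∑ i : ZMod N, Dxx N Δx j i = 0 := by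
  have h2 : (2 : ZMod N) ≠ 0 := by exact_mod_cast aux_nat_ne (N := N) 2 (by omega) (by omega)
  have h1 : (1 : ZMod N) ≠ 0 := by exact_mod_cast aux_nat_ne (N := N) 1 (by omega) (by omega)
  have hne : j + 1 ≠ j - 1 := fun h => h2 (by linear_combination h)
  have hne1 : j ≠ j + 1 := fun h => h1 (by linear_combination -h)
  have hne2 : j ≠ j - 1 := fun h => h1 (by linear_combination h)
  have : ∀ i : ZMod N, Dxx N Δx j i = (if i = j then -2 / Δx ^ 2 else 0)
      + (if i = j + 1 then 1 / Δx ^ 2 else 0)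
      + (if i = j - 1 then 1 / Δx ^ 2 else 0) := by
    intro i
    unfold Dxx
    by_cases h : i = j
    · rw [if_pos h, if_pos h, if_neg (h ▸ hne1), if_neg (h ▸ hne2)]
      ring
    · by_cases h' : i = j + 1
      · rw [if_neg h, if_neg h, if_pos h', if_pos h', if_neg (h' ▸ hne)]
        ring
      · rw [if_neg h, if_neg h, if_neg h', if_neg h']
        ring
  simp only [this, Finset.sum_add_distrib, Finset.sum_ite_eq', Finset.mem_univ, if_true]
  ring

/-- For the constant solution `g^n ≡ 1` and `σ = 0`, the naive advection-form
scheme reduces to the explicit Euler centered finite-difference discretization of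
`∂_t f + v ∂_x f = 0`: `f^{n+1}_{jk} = f^n_{jk} − Δt ∑_i D^x_{ji} f^n_{ik} v_k`. -/
theorem naive_scheme_reduces_to_explicit_Euler (N Nv : ℕ) [NeZero N] (hN : 3 ≤ N)
    (hNv : 1 ≤ Nv) (Δx Δt σ : ℝ) (hΔx : 0 < Δx) (hΔt : 0 < Δt) (hσ : σ = 0)
    (v ω : Fin Nv → ℝ) (hω : ∀ k, 0 < ω k)
    (ρn ρn1 : ZMod N → ℝ) (gn gn1 : ZMod N → Fin Nv → ℝ)
    (hρn : ∀ j, ρn j ≠ 0)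
    (hgn : ∀ (j : ZMod N) (k : Fin Nv), gn j k = 1)
    (hg : ∀ (j : ZMod N) (k : Fin Nv), gn1 j k = gn j k
        - Δt * ∑ i : ZMod N, Dx N Δx j i * gn i k * v k
        + Δt * (Δx / 2) * ∑ i : ZMod N, Dxx N Δx j i * gn i k * |v k|
        + σ * Δt * (1 - gn1 j k)
        - (gn1 j k / ρn j) * (ρn1 j - ρn j)
        - Δt * (gn j k / ρn j) * ∑ i : ZMod N, Dx N Δx j i * ρn i * v k) :
    ∀ (j : ZMod N) (k : Fin Nv),
      (1 / Real.sqrt (2 * Real.pi)) * ρn1 j * gn1 j k * Real.exp (-(v k) ^ 2 / 2)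
        = (1 / Real.sqrt (2 * Real.pi)) * ρn j * gn j k * Real.exp (-(v k) ^ 2 / 2)
          - Δt * ∑ i : ZMod N,
              Dx N Δx j i * ((1 / Real.sqrt (2 * Real.pi)) * ρn i * gn i k
                * Real.exp (-(v k) ^ 2 / 2)) * v k := by
  intro j k
  have h := hg j k
  simp only [hgn, mul_one, hσ, ← Finset.sum_mul, aux_Dx_sum N hN, aux_Dxx_sum N hN] at h
  have hr := hρn j
  have key : ρn1 j * gn1 j k = ρn j - Δt * ((∑ i : ZMod N, Dx N Δx j i * ρn i) * v k) := by
    field_simp at h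
    linear_combination h / 2
  have hs : ∑ i : ZMod N, Dx N Δx j i * ((1 / Real.sqrt (2 * Real.pi)) * ρn i * gn i k
                * Real.exp (-(v k) ^ 2 / 2)) * v k
      = (∑ i : ZMod N, Dx N Δx j i * ρn i)
        * ((1 / Real.sqrt (2 * Real.pi)) * Real.exp (-(v k) ^ 2 / 2) * v k) := by
    rw [Finset.sum_mul]
    refine Finset.sum_congr rfl fun i _ => ?_
    rw [hgn]
    ring
  rw [hs, hgn]
  linear_combination ((1 / Real.sqrt (2 * Real.pi)) * Real.exp (-(v k) ^ 2 / 2)) * key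
end

section
/- Let N ≥ 3, Δx > 0, let v_1,…,v_{N_v} ∈ ℝ with v_{k₀} ≠ 0 for some k₀, and ω_1,…,ω_{N_v} > 0. Then for every time step size Δt > 0 the explicit Euler centered finite-difference scheme f ↦ Φ(f), Φ(f)_{jk} = f_{jk} − Δt ∑_i D^x_{ji} f_{ik} v_k, is not stable in the H-norm: there exists a nonzero f ∈ ℝ^{N×N_v} with ‖Φ(f)‖_H² > ‖f‖_H². -/
open Finset

/-- Instability of the explicit Euler centered finite-difference scheme: for every
time step size `Δt > 0` there is a nonzero `f` whose `H`-norm strictly increases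
under one step `f ↦ f − Δt D^x f diag(v_k)`. -/
theorem explicit_Euler_centered_not_stable (N Nv : ℕ) [NeZero N] (hN : 3 ≤ N)
    (hNv : 1 ≤ Nv) (Δx : ℝ) (hΔx : 0 < Δx)
    (v ω : Fin Nv → ℝ) (hω : ∀ k, 0 < ω k) (hv : ∃ k₀, v k₀ ≠ 0)
    (Δt : ℝ) (hΔt : 0 < Δt) :
    ∃ f : ZMod N → Fin Nv → ℝ, f ≠ 0 ∧
      HnormSq v ω (fun j k => f j k - Δt * ∑ i : ZMod N, Dx N Δx j i * f i k * v k)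
        > HnormSq v ω f := by
  obtain ⟨k₀, hk₀⟩ := hv
  haveI : Fact (1 < N) := ⟨by omega⟩
  have h10 : (1 : ZMod N) ≠ 0 := one_ne_zero
  have hsum : ∀ (j : ZMod N) (k : Fin Nv),
      ∑ i : ZMod N, Dx N Δx j i * (if i = 0 ∧ k = k₀ then (1 : ℝ) else 0) * v k
        = if k = k₀ then Dx N Δx j 0 * v k else 0 := by
    intro j k
    rw [Finset.sum_eq_single (0 : ZMod N)]
    · by_cases hk : k = k₀ <;> simp [hk]
    · intro i _ hi
      simp [hi]
    · simp
  have h00 : Dx N Δx 0 0 = 0 := by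
    simp [Dx]
  have hm1 : Dx N Δx (-1) 0 = 1 / (2 * Δx) := by
    simp [Dx]
  have hpt : ∀ (j : ZMod N) (k : Fin Nv),
      (if j = 0 ∧ k = k₀ then (1 : ℝ) else 0) ^ 2 ≤
        ((if j = 0 ∧ k = k₀ then (1 : ℝ) else 0)
          - Δt * (if k = k₀ then Dx N Δx j 0 * v k else 0)) ^ 2 := by
    intro j k
    by_cases hj : j = 0
    · subst hj
      simp [h00]
    · simp only [hj, false_and, if_false]
      nlinarith [sq_nonneg (0 - Δt * (if k = k₀ then Dx N Δx j 0 * v k else 0))]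
  have hw : ∀ k, 0 < ω k * Real.exp (3 * (v k) ^ 2 / 2) :=
    fun k => mul_pos (hω k) (Real.exp_pos _)
  refine ⟨fun j k => if j = 0 ∧ k = k₀ then 1 else 0, ?_, ?_⟩
  · intro h
    have := congrFun (congrFun h 0) k₀
    simp at this
  · unfold HnormSq
    simp only [hsum]
    refine mul_lt_mul_of_pos_left ?_ (Real.sqrt_pos.mpr (by positivity))
    have hle : ∀ (j : ZMod N) (k : Fin Nv),
        (if j = 0 ∧ k = k₀ then (1 : ℝ) else 0) ^ 2 * ω k * Real.exp (3 * (v k) ^ 2 / 2) ≤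
        ((if j = 0 ∧ k = k₀ then (1 : ℝ) else 0)
          - Δt * (if k = k₀ then Dx N Δx j 0 * v k else 0)) ^ 2 * ω k
            * Real.exp (3 * (v k) ^ 2 / 2) := by
      intro j k
      rw [mul_assoc, mul_assoc]
      exact mul_le_mul_of_nonneg_right (hpt j k) (hw k).le
    refine Finset.sum_lt_sum (fun j _ => Finset.sum_le_sum fun k _ => hle j k)
      ⟨-1, Finset.mem_univ _, Finset.sum_lt_sum (fun k _ => hle _ k)
        ⟨k₀, Finset.mem_univ _, ?_⟩⟩
    rw [mul_assoc, mul_assoc]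
    refine mul_lt_mul_of_pos_right ?_ (hw k₀)
    have hne : Δt * (1 / (2 * Δx) * v k₀) ≠ 0 := by positivity
    have hneg : (-1 : ZMod N) ≠ 0 := neg_ne_zero.mpr h10
    simp only [hneg, false_and, if_false, if_true, hm1]
    have := pow_pos (abs_pos.mpr hne) 2
    rw [sq_abs] at this
    nlinarith
end

section
/- Let ρ^n, ρ^{n+1} ∈ ℝ^N with ρ^{n+1}_j ≠ 0 for all j, let g^n ∈ ℝ^{N×N_v}, let R ≤ N and R' ≤ N_v, and let X̂ ∈ ℝ^{N×R} and V̂ ∈ ℝ^{N_v×R'} have orthonormal columns (X̂ᵀX̂ = I_R, V̂ᵀV̂ = I_{R'}). Set P^X = X̂ X̂ᵀ and P^V = V̂ V̂ᵀ, and let g^{n+1} ∈ ℝ^{N×N_v} be the Galerkin (S-step) update: for all α, β, (1+σΔt) g^{n+1}_{αβ} = ∑_{j,k} (ρ^n_j/ρ^{n+1}_j) g^n_{jk} P^X_{αj} P^V_{kβ} − Δt ∑_{i,j,k} (1/ρ^{n+1}_j) D^x_{ji} ρ^n_i g^n_{ik} v_k P^X_{αj} P^V_{kβ} + Δt (Δx/2)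 ∑_{i,j,k} (1/ρ^{n+1}_j) D^xx_{ji} ρ^n_i g^n_{ik} |v_k| P^X_{αj} P^V_{kβ} + σΔt ∑_{j,k} P^X_{αj} P^V_{kβ}. Assume: (i) the ρ-update ρ^{n+1}_j = ρ^n_j − (Δt/√(2π)) ∑_{i,k} D^x_{ji} ρ^n_i g^n_{ik} v_k ω_k e^{v_k²/2} + (Δt Δx/(2√(2π))) ∑_{i,k} D^xx_{ji} ρ^n_i g^n_{ik} |v_k| ω_k e^{v_k²/2}; (ii) the basis-augmentation invariances ∑_α P^X_{jα} g^{n+1}_{αβ} (ρ^{n+1}_α)² = g^{n+1}_{jβ} (ρ^{n+1}_j)² for all j, β, and ∑_β P^V_{kβ} g^{n+1}_{jβ} ω_β e^{v_β²/2} = g^{n+1}_{jk} ω_k e^{v_k²/2} for all j, k; (iii) the moment conditions ∑_k g^n_{jk} ω_k e^{v_k²/2} = √(2π) and ∑_k g^{n+1}_{jk} ω_k e^{v_k²/2} = √(2π) for all j; (iv) the quadrature normalization ∑_k ω_k e^{v_k²/2} = √(2π); (v) σ ≥ 0, Δt > 0, and the CFL condition max_k |v_k| · Δt ≤ Δx.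 Then, with f^m_{jk} = (1/√(2π)) ρ^m_j g^m_{jk} e^{−v_k²/2} for m ∈ {n, n+1}, the dynamical low-rank scheme is numerically stable in the H-norm: ‖f^{n+1}‖_H² ≤ ‖f^n‖_H². -/
open Finset

theorem aux_Dx (N : ℕ) [NeZero N] (hN : 3 ≤ N) (Δx : ℝ) (f : ZMod N → ℝ) (j : ZMod N) :
    ∑ i, Dx N Δx j i * f i = (f (j + 1) - f (j - 1)) / (2 * Δx) := by
  have h2 : (2 : ZMod N) ≠ 0 := by
    intro h
    have h' : ((2 : ℕ) : ZMod N) = 0 := by exact_mod_cast h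
    rw [ZMod.natCast_eq_zero_iff] at h'
    have := Nat.le_of_dvd (by norm_num) h'
    omega
  have hne : j - 1 ≠ j + 1 := by
    intro h
    apply h2
    linear_combination -h
  have : ∀ i, Dx N Δx j i * f i = (if i = j + 1 then f i / (2 * Δx) else 0)
      + (if i = j - 1 then -(f i / (2 * Δx)) else 0) := by
    intro i
    unfold Dx
    by_cases h1 : i = j + 1
    · have h3 : i ≠ j - 1 := fun h => hne (h.symm.trans h1)
      rw [if_pos h1, if_pos h1, if_neg h3]; ring
    · by_cases h3 : i = j - 1
      · rw [if_neg h1, if_neg h1, if_pos h3, if_pos h3]; ring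
      · rw [if_neg h1, if_neg h1, if_neg h3, if_neg h3]; ring
  simp only [this, sum_add_distrib, sum_ite_eq', mem_univ, if_true]
  ring

theorem aux_Dxx (N : ℕ) [NeZero N] (hN : 3 ≤ N) (Δx : ℝ) (f : ZMod N → ℝ) (j : ZMod N) :
    ∑ i, Dxx N Δx j i * f i = (f (j + 1) - 2 * f j + f (j - 1)) / Δx ^ 2 := by
  have h2 : (2 : ZMod N) ≠ 0 := by
    intro h
    have h' : ((2 : ℕ) : ZMod N) = 0 := by exact_mod_cast h
    rw [ZMod.natCast_eq_zero_iff] at h'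
    have := Nat.le_of_dvd (by norm_num) h'
    omega
  have h10 : (1 : ZMod N) ≠ 0 := by
    intro h
    apply h2
    linear_combination 2 * h
  have hne : j - 1 ≠ j + 1 := by
    intro h
    apply h2
    linear_combination -h
  have hnp : j + 1 ≠ j := by
    intro h
    apply h10
    linear_combination h
  have hnm : j - 1 ≠ j := by
    intro h
    apply h10
    linear_combination -h
  have : ∀ i, Dxx N Δx j i * f i = (if i = j then -2 / Δx ^ 2 * f i else 0)
      + (if i = j + 1 then f i / Δx ^ 2 else 0)
      + (if i = j - 1 then f i / Δx ^ 2 else 0) := by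
    intro i
    unfold Dxx
    by_cases h0 : i = j
    · have h1 : i ≠ j + 1 := fun h => hnp (h.symm.trans h0)
      have h3 : i ≠ j - 1 := fun h => hnm (h.symm.trans h0)
      rw [if_pos h0, if_pos h0, if_neg h1, if_neg h3]; ring
    · by_cases h1 : i = j + 1
      · have h3 : i ≠ j - 1 := fun h => hne (h.symm.trans h1)
        rw [if_neg h0, if_neg h0, if_pos h1, if_pos h1, if_neg h3]; ring
      · by_cases h3 : i = j - 1
        · rw [if_neg h0, if_neg h0, if_neg h1, if_neg h1, if_pos h3, if_pos h3]; ring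
        · rw [if_neg h0, if_neg h0, if_neg h1, if_neg h1, if_neg h3, if_neg h3]; ring
  simp only [this, sum_add_distrib, sum_ite_eq', mem_univ, if_true]
  ring

/-- Testing the projected equation with an invariant test function removes the projections. -/
theorem aux_test {A B : Type*} [Fintype A] [Fintype B] (PX : A → A → ℝ) (PV : B → B → ℝ)
    (g F : A → B → ℝ) (r : A → ℝ) (w : B → ℝ)
    (hX : ∀ j β, ∑ α, PX α j * g α β * r α = g j β * r j)
    (hV : ∀ j k, ∑ β, PV k β * g j β * w β = g j k * w k) :
    ∑ α, ∑ β, g α β * r α * w β * ∑ j, ∑ k, F j k * PX α j * PV k β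
      = ∑ j, ∑ k, F j k * (g j k * r j * w k) := by
  calc ∑ α, ∑ β, g α β * r α * w β * ∑ j, ∑ k, F j k * PX α j * PV k β
      = ∑ α, ∑ β, ∑ j, ∑ k, F j k * PV k β * w β * (PX α j * g α β * r α) := by
        simp only [mul_sum]
        refine sum_congr rfl fun α _ => sum_congr rfl fun β _ => sum_congr rfl fun j _ =>
          sum_congr rfl fun k _ => by ring
    _ = ∑ β, ∑ j, ∑ k, ∑ α, F j k * PV k β * w β * (PX α j * g α β * r α) := by
        rw [sum_comm]
        refine sum_congr rfl fun β _ => ?_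
        rw [sum_comm]
        refine sum_congr rfl fun j _ => ?_
        rw [sum_comm]
    _ = ∑ β, ∑ j, ∑ k, F j k * r j * (PV k β * g j β * w β) := by
        refine sum_congr rfl fun β _ => sum_congr rfl fun j _ => sum_congr rfl fun k _ => ?_
        rw [← mul_sum, hX]; ring
    _ = ∑ j, ∑ k, ∑ β, F j k * r j * (PV k β * g j β * w β) := by
        rw [sum_comm]
        refine sum_congr rfl fun j _ => ?_
        rw [sum_comm]
    _ = _ := by
        refine sum_congr rfl fun j _ => sum_congr rfl fun k _ => ?_
        rw [← mul_sum, hV]; ring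

/-- Convexity estimate for the upwind step. -/
theorem aux_convex (l m a b c y : ℝ) (hl : l ≤ 1) (h1 : m ≤ l) (h2 : -m ≤ l) :
    2 * (((1 - l) * a + (l - m) / 2 * b + (l + m) / 2 * c) * y)
      ≤ (1 - l) * a ^ 2 + (l - m) / 2 * b ^ 2 + (l + m) / 2 * c ^ 2 + y ^ 2 := by
  have e1 : 0 ≤ (1 - l) * (a - y) ^ 2 := mul_nonneg (by linarith) (sq_nonneg _)
  have e2 : 0 ≤ (l - m) / 2 * (b - y) ^ 2 := mul_nonneg (by linarith) (sq_nonneg _)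
  have e3 : 0 ≤ (l + m) / 2 * (c - y) ^ 2 := mul_nonneg (by linarith) (sq_nonneg _)
  nlinarith

theorem aux_H {N Nv : ℕ} [NeZero N] (v ω : Fin Nv → ℝ) (ρ : ZMod N → ℝ)
    (g : ZMod N → Fin Nv → ℝ) :
    HnormSq v ω (fun j k =>
        (1 / Real.sqrt (2 * Real.pi)) * ρ j * g j k * Real.exp (-(v k) ^ 2 / 2))
      = Real.sqrt (2 * Real.pi) * (1 / Real.sqrt (2 * Real.pi)) ^ 2 *
        ∑ j, ∑ k, (ρ j * g j k) ^ 2 * (ω k * Real.exp ((v k) ^ 2 / 2)) := by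
  unfold HnormSq
  rw [mul_assoc]
  congr 1
  rw [mul_sum]
  refine sum_congr rfl fun j _ => ?_
  rw [mul_sum]
  refine sum_congr rfl fun k _ => ?_
  have : Real.exp ((v k) ^ 2 / 2) = Real.exp (-(v k) ^ 2 / 2) ^ 2 * Real.exp (3 * (v k) ^ 2 / 2) := by
    rw [← Real.exp_nat_mul, ← Real.exp_add]
    congr 1
    push_cast
    ring
  rw [this]
  ring

/-- Numerical stability of the dynamical low-rank (basis-augmented BUG) scheme:
under the CFL condition `max_k |v_k| Δt ≤ Δx` and the basis-augmentation invariances,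
the Galerkin (S-step) update satisfies `‖f^{n+1}‖_H² ≤ ‖f^n‖_H²`, where
`f^m_{jk} = (1/√(2π)) ρ^m_j g^m_{jk} e^{−v_k²/2}`. -/
theorem DLRA_scheme_numerically_stable (N Nv R R' : ℕ) [NeZero N] (hN : 3 ≤ N)
    (hNv : 1 ≤ Nv) (hR : R ≤ N) (hR' : R' ≤ Nv)
    (Δx Δt σ : ℝ) (hΔx : 0 < Δx) (hΔt : 0 < Δt) (hσ : 0 ≤ σ)
    (v ω : Fin Nv → ℝ) (hω : ∀ k, 0 < ω k)
    (ρn ρn1 : ZMod N → ℝ) (hρn1 : ∀ j, ρn1 j ≠ 0)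
    (gn gn1 : ZMod N → Fin Nv → ℝ)
    (X : ZMod N → Fin R → ℝ) (V : Fin Nv → Fin R' → ℝ)
    -- orthonormal columns
    (hX : ∀ p q : Fin R, ∑ j : ZMod N, X j p * X j q = if p = q then (1 : ℝ) else 0)
    (hV : ∀ p q : Fin R', ∑ k : Fin Nv, V k p * V k q = if p = q then (1 : ℝ) else 0)
    -- orthogonal projections onto the augmented bases
    (PX : ZMod N → ZMod N → ℝ) (PV : Fin Nv → Fin Nv → ℝ)
    (hPX : ∀ α j, PX α j = ∑ p : Fin R, X α p * X j p)
    (hPV : ∀ k β, PV k β = ∑ p : Fin R', V k p * V β p)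
    -- Galerkin (S-step) update
    (hS : ∀ (α : ZMod N) (β : Fin Nv), (1 + σ * Δt) * gn1 α β =
        (∑ j : ZMod N, ∑ k : Fin Nv, (ρn j / ρn1 j) * gn j k * PX α j * PV k β)
        - Δt * ∑ j : ZMod N, ∑ i : ZMod N, ∑ k : Fin Nv,
            (1 / ρn1 j) * Dx N Δx j i * (ρn i * gn i k) * v k * PX α j * PV k β
        + Δt * (Δx / 2) * ∑ j : ZMod N, ∑ i : ZMod N, ∑ k : Fin Nv,
            (1 / ρn1 j) * Dxx N Δx j i * (ρn i * gn i k) * |v k| * PX α j * PV k β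
        + σ * Δt * ∑ j : ZMod N, ∑ k : Fin Nv, PX α j * PV k β)
    -- (i) the ρ-update
    (hρ : ∀ j : ZMod N, ρn1 j = ρn j
        - (Δt / Real.sqrt (2 * Real.pi)) * ∑ i : ZMod N, ∑ k : Fin Nv,
            Dx N Δx j i * (ρn i * gn i k) * v k * ω k * Real.exp ((v k) ^ 2 / 2)
        + (Δt * Δx / (2 * Real.sqrt (2 * Real.pi))) * ∑ i : ZMod N, ∑ k : Fin Nv,
            Dxx N Δx j i * (ρn i * gn i k) * |v k| * ω k * Real.exp ((v k) ^ 2 / 2))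
    -- (ii) basis-augmentation invariances
    (hinvX : ∀ (j : ZMod N) (β : Fin Nv),
        ∑ α : ZMod N, PX α j * gn1 α β * (ρn1 α) ^ 2 = gn1 j β * (ρn1 j) ^ 2)
    (hinvV : ∀ (j : ZMod N) (k : Fin Nv),
        ∑ β : Fin Nv, PV k β * gn1 j β * ω β * Real.exp ((v β) ^ 2 / 2)
          = gn1 j k * ω k * Real.exp ((v k) ^ 2 / 2))
    -- (iii) moment conditions
    (hmomn : ∀ j, ∑ k : Fin Nv, gn j k * ω k * Real.exp ((v k) ^ 2 / 2)
        = Real.sqrt (2 * Real.pi))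
    (hmomn1 : ∀ j, ∑ k : Fin Nv, gn1 j k * ω k * Real.exp ((v k) ^ 2 / 2)
        = Real.sqrt (2 * Real.pi))
    -- (iv) quadrature normalization
    (hquad : ∑ k : Fin Nv, ω k * Real.exp ((v k) ^ 2 / 2) = Real.sqrt (2 * Real.pi))
    -- (v) CFL condition
    (hCFL : ∀ k, |v k| * Δt ≤ Δx) :
    HnormSq v ω (fun j k =>
        (1 / Real.sqrt (2 * Real.pi)) * ρn1 j * gn1 j k * Real.exp (-(v k) ^ 2 / 2))
      ≤ HnormSq v ω (fun j k =>
        (1 / Real.sqrt (2 * Real.pi)) * ρn j * gn j k * Real.exp (-(v k) ^ 2 / 2)) := by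
  rw [aux_H, aux_H]
  refine mul_le_mul_of_nonneg_left ?_ (by positivity)
  set s := Real.sqrt (2 * Real.pi) with hs
  have hs0 : 0 < s := by rw [hs]; positivity
  obtain ⟨w, hw⟩ : ∃ w : Fin Nv → ℝ, ∀ k, w k = ω k * Real.exp ((v k) ^ 2 / 2) := ⟨_, fun _ => rfl⟩
  have hw0 : ∀ k, 0 < w k := fun k => by rw [hw]; exact mul_pos (hω k) (Real.exp_pos _)
  simp only [mul_assoc _ (ω _) (Real.exp _), ← hw] at hinvV hmomn1 hquad ⊢
  -- the upwind step
  obtain ⟨T, hT⟩ : ∃ T : ZMod N → Fin Nv → ℝ, ∀ j k, T j k =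
      (1 - Δt * |v k| / Δx) * (ρn j * gn j k)
      + (Δt * |v k| / Δx - Δt * v k / Δx) / 2 * (ρn (j + 1) * gn (j + 1) k)
      + (Δt * |v k| / Δx + Δt * v k / Δx) / 2 * (ρn (j - 1) * gn (j - 1) k) := ⟨_, fun _ _ => rfl⟩
  have hS' : ∀ α β, (1 + σ * Δt) * gn1 α β =
      ∑ j, ∑ k, (1 / ρn1 j * T j k + σ * Δt) * PX α j * PV k β := by
    intro α β
    rw [hS, mul_sum, mul_sum, mul_sum, ← sum_sub_distrib, ← sum_add_distrib, ← sum_add_distrib]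
    refine sum_congr rfl fun j _ => ?_
    rw [sum_comm, sum_comm (s := (univ : Finset (ZMod N))) (t := (univ : Finset (Fin Nv))),
      mul_sum, mul_sum, mul_sum, ← sum_sub_distrib, ← sum_add_distrib, ← sum_add_distrib]
    refine sum_congr rfl fun k _ => ?_
    have e1 : ∑ i, (1 / ρn1 j) * Dx N Δx j i * (ρn i * gn i k) * v k * PX α j * PV k β
        = 1 / ρn1 j * v k * PX α j * PV k β * ∑ i, Dx N Δx j i * (ρn i * gn i k) := by
      rw [mul_sum]
      exact sum_congr rfl fun i _ => by ring
    have e2 : ∑ i, (1 / ρn1 j) * Dxx N Δx j i * (ρn i * gn i k) * |v k| * PX α j * PV k β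
        = 1 / ρn1 j * |v k| * PX α j * PV k β * ∑ i, Dxx N Δx j i * (ρn i * gn i k) := by
      rw [mul_sum]
      exact sum_congr rfl fun i _ => by ring
    rw [e1, e2, aux_Dx N hN Δx (fun i => ρn i * gn i k),
      aux_Dxx N hN Δx (fun i => ρn i * gn i k), hT]
    have := hρn1 j
    field_simp
    ring
  have key := aux_test PX PV gn1 (fun j k => 1 / ρn1 j * T j k + σ * Δt) (fun j => ρn1 j ^ 2) w
    hinvX (fun j k => hinvV j k)
  simp only [← hS'] at key
  have hL : ∑ α, ∑ β, gn1 α β * ρn1 α ^ 2 * w β * ((1 + σ * Δt) * gn1 α β)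
      = (1 + σ * Δt) * ∑ j, ∑ k, (ρn1 j * gn1 j k) ^ 2 * w k := by
    simp only [mul_sum]
    exact sum_congr rfl fun j _ => sum_congr rfl fun k _ => by ring
  have hRr : ∑ j, ∑ k, (1 / ρn1 j * T j k + σ * Δt) * (gn1 j k * ρn1 j ^ 2 * w k)
      = ∑ j, ∑ k, T j k * (ρn1 j * gn1 j k) * w k + σ * Δt * ∑ j, s * ρn1 j ^ 2 := by
    rw [mul_sum, ← sum_add_distrib]
    refine sum_congr rfl fun j _ => ?_
    rw [← hmomn1 j, sum_mul, mul_sum, ← sum_add_distrib]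
    refine sum_congr rfl fun k _ => ?_
    have := hρn1 j
    field_simp
  rw [hL, hRr] at key
  have hmom : ∑ j, s * ρn1 j ^ 2 ≤ ∑ j, ∑ k, (ρn1 j * gn1 j k) ^ 2 * w k := by
    refine sum_le_sum fun j _ => ?_
    have h0 : 0 ≤ ∑ k, ρn1 j ^ 2 * (gn1 j k - 1) ^ 2 * w k :=
      sum_nonneg fun k _ => mul_nonneg (by positivity) (hw0 k).le
    have h1 : ∑ k, ρn1 j ^ 2 * (gn1 j k - 1) ^ 2 * w k
        = ∑ k, (ρn1 j * gn1 j k) ^ 2 * w k - 2 * ρn1 j ^ 2 * ∑ k, gn1 j k * w k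
          + ρn1 j ^ 2 * ∑ k, w k := by
      rw [mul_sum, mul_sum, ← sum_sub_distrib, ← sum_add_distrib]
      exact sum_congr rfl fun k _ => by ring
    rw [hmomn1, hquad] at h1
    linarith
  have hconv : 2 * ∑ j, ∑ k, T j k * (ρn1 j * gn1 j k) * w k
      ≤ ∑ j, ∑ k, (ρn j * gn j k) ^ 2 * w k + ∑ j, ∑ k, (ρn1 j * gn1 j k) ^ 2 * w k := by
    rw [sum_comm, sum_comm (f := fun j k => (ρn j * gn j k) ^ 2 * w k),
      sum_comm (f := fun j k => (ρn1 j * gn1 j k) ^ 2 * w k), mul_sum, ← sum_add_distrib]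
    refine sum_le_sum fun k _ => ?_
    have hl : Δt * |v k| / Δx ≤ 1 := by
      rw [div_le_one hΔx, mul_comm]; exact hCFL k
    have h1 : Δt * v k / Δx ≤ Δt * |v k| / Δx := by
      have := le_abs_self (v k)
      gcongr
    have h2 : -(Δt * v k / Δx) ≤ Δt * |v k| / Δx := by
      have := neg_le_abs (v k)
      have e : -(Δt * v k / Δx) = Δt * (-v k) / Δx := by ring
      rw [e]
      gcongr
    set l := Δt * |v k| / Δx with hldef
    set m := Δt * v k / Δx with hmdef
    have sh1 : ∑ j : ZMod N, (ρn (j + 1) * gn (j + 1) k) ^ 2 = ∑ j, (ρn j * gn j k) ^ 2 :=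
      Equiv.sum_comp (Equiv.addRight (1 : ZMod N)) (fun j => (ρn j * gn j k) ^ 2)
    have sh2 : ∑ j : ZMod N, (ρn (j - 1) * gn (j - 1) k) ^ 2 = ∑ j, (ρn j * gn j k) ^ 2 :=
      Equiv.sum_comp (Equiv.subRight (1 : ZMod N)) (fun j => (ρn j * gn j k) ^ 2)
    have hpt : ∑ j, 2 * (T j k * (ρn1 j * gn1 j k)) ≤
        ∑ j, ((1 - l) * (ρn j * gn j k) ^ 2 + (l - m) / 2 * (ρn (j + 1) * gn (j + 1) k) ^ 2
          + (l + m) / 2 * (ρn (j - 1) * gn (j - 1) k) ^ 2 + (ρn1 j * gn1 j k) ^ 2) := by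
      refine sum_le_sum fun j _ => ?_
      rw [hT]
      exact aux_convex l m _ _ _ _ hl h1 h2
    rw [sum_add_distrib, sum_add_distrib, sum_add_distrib, ← mul_sum, ← mul_sum, ← mul_sum,
      ← mul_sum, sh1, sh2] at hpt
    rw [← sum_mul, ← sum_mul, ← sum_mul, ← mul_assoc, ← add_mul]
    refine mul_le_mul_of_nonneg_right ?_ (hw0 k).le
    linarith
  have hσt : 0 ≤ σ * Δt := mul_nonneg hσ hΔt.le
  have := mul_le_mul_of_nonneg_left hmom hσt
  linarith
end
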